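/- Let N be a homogeneous quasi-norm on the step-2 group, smooth away from the origin and satisfying Condition (G) with index j₀ and integer γ ≥ 2, let p ≥ 2γ, q = p/(p−1) and a > 0. Then there exists δ₀ > 0 with the following property: if W : ℝ^{n₁}×ℝⁿ → ℝ is a differentiable potential satisfying |∇_G W(z)|^q ≤ δ N(z)^{p−2γ} |x_{j₀}|^{2γ} + γ_δ for all z, for some 0 < δ < δ₀ and some γ_δ > 0, and if μ_W := Ẑ⁻¹ e^{−W} dμ_p is the normalized perturbed probability measure (with Ẑ = ∫ e^{−W} dμ_p finite), then there exist constants A' > 0 and B' ≥ 0 such that ∫ |f|^q N^{p−2γ} |x_{j₀}|^{2γ} dμ_W ≤ A' ∫ |∇_G f|^q dμ_W + B' ∫ |f|^q dμ_W for every smooth compactly supported f. -/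

import Mathlib

open Real Finset Matrix MeasureTheory

/-- The generating vector fields `X_j` of a step-2 Carnot group on `ℝ^{n₁} × ℝⁿ` defined by
skew-symmetric matrices `B⁽ᵏ⁾`:
`X_j f(x,t) = ∂_{x_j} f(x,t) + (1/2) Σ_k Σ_i B⁽ᵏ⁾_{ij} x_i ∂_{t_k} f(x,t)`. -/
noncomputable def Xvf {n₁ n : ℕ} (B : Fin n → Matrix (Fin n₁) (Fin n₁) ℝ) (j : Fin n₁)
    (f : (Fin n₁ → ℝ) × (Fin n → ℝ) → ℝ) (z : (Fin n₁ → ℝ) × (Fin n → ℝ)) : ℝ :=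
  fderiv ℝ f z (Pi.single j 1, 0) +
    (1 / 2) * ∑ k : Fin n, (∑ i : Fin n₁, B k i j * z.1 i) * fderiv ℝ f z (0, Pi.single k 1)

/-- The squared length of the sub-gradient: `|∇_G f|² = Σ_j (X_j f)²`. -/
noncomputable def gradSq {n₁ n : ℕ} (B : Fin n → Matrix (Fin n₁) (Fin n₁) ℝ)
    (f : (Fin n₁ → ℝ) × (Fin n → ℝ) → ℝ) (z : (Fin n₁ → ℝ) × (Fin n → ℝ)) : ℝ :=
  ∑ j : Fin n₁, (Xvf B j f z) ^ 2

/-- The length `|∇_G f|` of the sub-gradient. -/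
noncomputable def gradLen {n₁ n : ℕ} (B : Fin n → Matrix (Fin n₁) (Fin n₁) ℝ)
    (f : (Fin n₁ → ℝ) × (Fin n → ℝ) → ℝ) (z : (Fin n₁ → ℝ) × (Fin n → ℝ)) : ℝ :=
  Real.sqrt (gradSq B f z)

/-- The sub-Laplacian `Δ_G f = Σ_j X_j (X_j f)`. -/
noncomputable def subLap {n₁ n : ℕ} (B : Fin n → Matrix (Fin n₁) (Fin n₁) ℝ)
    (f : (Fin n₁ → ℝ) × (Fin n → ℝ) → ℝ) (z : (Fin n₁ → ℝ) × (Fin n → ℝ)) : ℝ :=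
  ∑ j : Fin n₁, Xvf B j (Xvf B j f) z

/-- The dilations `δ_λ(x,t) = (λ x, λ² t)` of the step-2 group. -/
def dil2 {n₁ n : ℕ} (l : ℝ) (z : (Fin n₁ → ℝ) × (Fin n → ℝ)) :
    (Fin n₁ → ℝ) × (Fin n → ℝ) :=
  (fun i => l * z.1 i, fun k => l ^ 2 * z.2 k)

/-- A homogeneous quasi-norm on the step-2 group: continuous, nonnegative, vanishing
exactly at the origin, and `N(δ_λ(z)) = λ N(z)` for all `λ > 0`. -/
def IsHomQuasiNorm2 {n₁ n : ℕ} (N : (Fin n₁ → ℝ) × (Fin n → ℝ) → ℝ) : Prop :=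
  Continuous N ∧ (∀ z, 0 ≤ N z) ∧ (∀ z, N z = 0 ↔ z = 0) ∧
    ∀ l : ℝ, 0 < l → ∀ z, N (dil2 l z) = l * N z

/-- The probability measure `μ_p = Z⁻¹ e^{−a N(z)^p} dz` on the step-2 group. -/
noncomputable def muP {n₁ n : ℕ} (N : (Fin n₁ → ℝ) × (Fin n → ℝ) → ℝ) (a p : ℝ) :
    Measure ((Fin n₁ → ℝ) × (Fin n → ℝ)) :=
  ((∫⁻ z, ENNReal.ofReal (Real.exp (-(a * N z ^ p))))⁻¹) •
    (volume.withDensity fun z => ENNReal.ofReal (Real.exp (-(a * N z ^ p))))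

/-- The normalized perturbed probability measure `μ_W = Ẑ⁻¹ e^{−W} dμ_p`. -/
noncomputable def muW {n₁ n : ℕ} (N : (Fin n₁ → ℝ) × (Fin n → ℝ) → ℝ) (a p : ℝ)
    (W : (Fin n₁ → ℝ) × (Fin n → ℝ) → ℝ) : Measure ((Fin n₁ → ℝ) × (Fin n → ℝ)) :=
  ((∫⁻ z, ENNReal.ofReal (Real.exp (-W z)) ∂(muP N a p))⁻¹) •
    ((muP N a p).withDensity fun z => ENNReal.ofReal (Real.exp (-W z)))

/-- The value of the vector field `X_j` at `z`. -/
noncomputable def vfld {n₁ n : ℕ} (B : Fin n → Matrix (Fin n₁) (Fin n₁) ℝ) (j : Fin n₁)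
    (z : (Fin n₁ → ℝ) × (Fin n → ℝ)) : (Fin n₁ → ℝ) × (Fin n → ℝ) :=
  (Pi.single j 1, fun k => (1 / 2) * ∑ i : Fin n₁, B k i j * z.1 i)

lemma Xvf_eq {n₁ n : ℕ} (B : Fin n → Matrix (Fin n₁) (Fin n₁) ℝ) (j : Fin n₁)
    (f : (Fin n₁ → ℝ) × (Fin n → ℝ) → ℝ) (z : (Fin n₁ → ℝ) × (Fin n → ℝ)) :
    Xvf B j f z = fderiv ℝ f z (vfld B j z) := by
  have h : vfld B j z = ((Pi.single j 1, 0) : (Fin n₁ → ℝ) × (Fin n → ℝ)) +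
      ∑ k : Fin n, ((1 / 2) * ∑ i : Fin n₁, B k i j * z.1 i) •
        ((0, Pi.single k 1) : (Fin n₁ → ℝ) × (Fin n → ℝ)) := by
    ext i
    · simp [vfld, Prod.fst_sum]
    · simp [vfld, Prod.snd_sum, Finset.sum_apply, Pi.single_apply]
  rw [h, map_add, map_sum, Xvf, Finset.mul_sum]
  congr 1
  refine Finset.sum_congr rfl fun k _ => ?_
  rw [map_smul, smul_eq_mul, mul_assoc]

lemma contDiff_vfld {n₁ n : ℕ} (B : Fin n → Matrix (Fin n₁) (Fin n₁) ℝ) (j : Fin n₁) :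
    ContDiff ℝ (⊤ : ℕ∞) (vfld B j) := by
  unfold vfld
  fun_prop

lemma measurable_Xvf {n₁ n : ℕ} (B : Fin n → Matrix (Fin n₁) (Fin n₁) ℝ) (j : Fin n₁)
    (f : (Fin n₁ → ℝ) × (Fin n → ℝ) → ℝ) : Measurable (Xvf B j f) := by
  have h := fun y => measurable_fderiv_apply_const ℝ f y
  unfold Xvf
  refine (h _).add (Measurable.const_mul ?_ _)
  refine Finset.measurable_sum _ fun k _ => Measurable.mul ?_ (h _)
  refine Finset.measurable_sum _ fun i _ => ?_
  fun_prop

lemma Xvf_mul {n₁ n : ℕ} (B : Fin n → Matrix (Fin n₁) (Fin n₁) ℝ) (j : Fin n₁)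
    {f g : (Fin n₁ → ℝ) × (Fin n → ℝ) → ℝ} {z : (Fin n₁ → ℝ) × (Fin n → ℝ)}
    (hf : DifferentiableAt ℝ f z) (hg : DifferentiableAt ℝ g z) :
    Xvf B j (fun z => f z * g z) z = f z * Xvf B j g z + g z * Xvf B j f z := by
  simp only [Xvf_eq]
  rw [fderiv_fun_mul hf hg]
  simp

lemma Xvf_comp {n₁ n : ℕ} (B : Fin n → Matrix (Fin n₁) (Fin n₁) ℝ) (j : Fin n₁)
    {f : (Fin n₁ → ℝ) × (Fin n → ℝ) → ℝ} {z : (Fin n₁ → ℝ) × (Fin n → ℝ)} {φ : ℝ → ℝ} {φ' : ℝ}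
    (hφ : HasDerivAt φ φ' (f z)) (hf : DifferentiableAt ℝ f z) :
    Xvf B j (fun z => φ (f z)) z = φ' * Xvf B j f z := by
  simp only [Xvf_eq]
  have := (hφ.comp_hasFDerivAt z hf.hasFDerivAt).fderiv
  simp only [Function.comp_def] at this
  rw [this]
  simp

lemma Xvf_congr {n₁ n : ℕ} (B : Fin n → Matrix (Fin n₁) (Fin n₁) ℝ) (j : Fin n₁)
    {f g : (Fin n₁ → ℝ) × (Fin n → ℝ) → ℝ} {z : (Fin n₁ → ℝ) × (Fin n → ℝ)}
    (h : f =ᶠ[nhds z] g) : Xvf B j f z = Xvf B j g z := by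
  simp only [Xvf_eq]
  rw [h.fderiv_eq]

lemma skew_diag {n₁ n : ℕ} (B : Fin n → Matrix (Fin n₁) (Fin n₁) ℝ)
    (hskew : ∀ k, (B k)ᵀ = -(B k)) (k : Fin n) (j : Fin n₁) : B k j j = 0 := by
  have := congrFun (congrFun (hskew k) j) j
  simp at this
  linarith

lemma vfld_flow {n₁ n : ℕ} (B : Fin n → Matrix (Fin n₁) (Fin n₁) ℝ)
    (hskew : ∀ k, (B k)ᵀ = -(B k)) (j : Fin n₁) (z : (Fin n₁ → ℝ) × (Fin n → ℝ)) (s : ℝ) :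
    vfld B j (z + s • vfld B j z) = vfld B j z := by
  ext i
  · simp [vfld]
  · simp [vfld, mul_add, Finset.sum_add_distrib, Pi.single_apply, skew_diag B hskew]

lemma flow_measurePreserving {n₁ n : ℕ} (B : Fin n → Matrix (Fin n₁) (Fin n₁) ℝ)
    (j : Fin n₁) (s : ℝ) :
    MeasurePreserving (fun z : (Fin n₁ → ℝ) × (Fin n → ℝ) => z + s • vfld B j z) := by
  have h := MeasurePreserving.skew_product (μa := (volume : Measure (Fin n₁ → ℝ)))
    (μc := (volume : Measure (Fin n → ℝ))) (μd := (volume : Measure (Fin n → ℝ)))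
    (measurePreserving_add_right (volume : Measure (Fin n₁ → ℝ)) (s • (Pi.single j 1)))
    (g := fun x t => t + s • (fun k => (1 / 2) * ∑ i : Fin n₁, B k i j * x i))
    (by
      apply Continuous.measurable
      simp only [Function.uncurry_def]
      fun_prop)
    (Filter.Eventually.of_forall fun x => (measurePreserving_add_right _ _).map_eq)
  exact h

lemma Xvf_integral_zero {n₁ n : ℕ} (B : Fin n → Matrix (Fin n₁) (Fin n₁) ℝ)
    (hskew : ∀ k, (B k)ᵀ = -(B k)) (j : Fin n₁)
    (u : (Fin n₁ → ℝ) × (Fin n → ℝ) → ℝ) (hu : Differentiable ℝ u) (hc : HasCompactSupport u)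
    (C : ℝ) (hC : ∀ z, |Xvf B j u z| ≤ C) :
    Integrable (Xvf B j u) ∧ ∫ z, Xvf B j u z = 0 := by
  set K : Set ((Fin n₁ → ℝ) × (Fin n → ℝ)) :=
    (fun y : ℝ × ((Fin n₁ → ℝ) × (Fin n → ℝ)) => y.2 + (-y.1) • vfld B j y.2) ''
      (Set.Icc (-1) 1 ×ˢ tsupport u) with hK
  have hKc : IsCompact K := by
    refine (isCompact_Icc.prod hc).image ?_
    have := (contDiff_vfld B j).continuous
    fun_prop
  have hcont : ∀ s : ℝ, Continuous fun z : (Fin n₁ → ℝ) × (Fin n → ℝ) => z + s • vfld B j z := by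
    intro s
    have := (contDiff_vfld B j).continuous
    fun_prop
  have key := hasDerivAt_integral_of_dominated_loc_of_deriv_le
    (μ := (volume : Measure ((Fin n₁ → ℝ) × (Fin n → ℝ))))
    (F := fun (s : ℝ) z => u (z + s • vfld B j z))
    (F' := fun (s : ℝ) z => Xvf B j u (z + s • vfld B j z)) (x₀ := (0 : ℝ))
    (s := Set.Icc (-1) 1) (bound := K.indicator fun _ => C)
    (Icc_mem_nhds (by norm_num) (by norm_num))
    (Filter.Eventually.of_forall fun s => (hu.continuous.comp (hcont s)).aestronglyMeasurable)
    (by simpa using hu.continuous.integrable_of_hasCompactSupport hc)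
    (by simpa using (measurable_Xvf B j u).aestronglyMeasurable)
    (Filter.Eventually.of_forall fun z s hs => by
      by_cases hz : z + s • vfld B j z ∈ tsupport u
      · have : z ∈ K := by
          refine ⟨(s, z + s • vfld B j z), ⟨hs, hz⟩, ?_⟩
          simp only [vfld_flow B hskew]
          module
        rw [Set.indicator_of_mem this]
        exact hC _
      · have h0 : Xvf B j u (z + s • vfld B j z) = 0 := by
          rw [Xvf_eq, fderiv_of_notMem_tsupport ℝ hz]; simp
        rw [h0, norm_zero]
        exact Set.indicator_nonneg (fun _ _ => (abs_nonneg _).trans (hC 0)) _)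
    ((integrable_indicator_iff hKc.measurableSet).2
      (integrableOn_const hKc.measure_lt_top.ne))
    (Filter.Eventually.of_forall fun z s _ => by
      rw [Xvf_eq, vfld_flow B hskew]
      have h1 : HasDerivAt (fun s : ℝ => z + s • vfld B j z) (vfld B j z) s := by
        simpa using ((hasDerivAt_id s).smul_const (vfld B j z)).const_add z
      exact (hu _).hasFDerivAt.comp_hasDerivAt s h1)
  simp only [zero_smul, add_zero] at key
  refine ⟨key.1, ?_⟩
  have hconst : (fun s : ℝ => ∫ z, u (z + s • vfld B j z)) = fun _ => ∫ z, u z := by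
    funext s
    have hm := flow_measurePreserving B j s
    have := integral_map (μ := (volume : Measure ((Fin n₁ → ℝ) × (Fin n → ℝ))))
      hm.measurable.aemeasurable (f := u) hu.continuous.aestronglyMeasurable
    rw [hm.map_eq] at this
    exact this.symm
  have h2 := key.2
  rw [hconst] at h2
  exact h2.unique (hasDerivAt_const _ _)

lemma dil2_eq_zero {n₁ n : ℕ} {l : ℝ} (hl : 0 < l) (z : (Fin n₁ → ℝ) × (Fin n → ℝ))
    (hz : z ≠ 0) : dil2 l z ≠ 0 := by
  intro h
  apply hz
  have h1 := congrArg Prod.fst h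
  have h2 := congrArg Prod.snd h
  ext i
  · have := congrFun h1 i
    simpa [dil2, hl.ne'] using this
  · have := congrFun h2 i
    simpa [dil2, hl.ne'] using this

/-- `X_j` of a degree one function is homogeneous of degree zero. -/
lemma Xvf_hom {n₁ n : ℕ} (B : Fin n → Matrix (Fin n₁) (Fin n₁) ℝ) (j : Fin n₁)
    (F : (Fin n₁ → ℝ) × (Fin n → ℝ) → ℝ) (hF : ∀ z, z ≠ 0 → DifferentiableAt ℝ F z)
    (hh : ∀ l : ℝ, 0 < l → ∀ z, F (dil2 l z) = l * F z)
    (l : ℝ) (hl : 0 < l) (z : (Fin n₁ → ℝ) × (Fin n → ℝ)) (hz : z ≠ 0) :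
    Xvf B j F (dil2 l z) = Xvf B j F z := by
  let D : ((Fin n₁ → ℝ) × (Fin n → ℝ)) →L[ℝ] ((Fin n₁ → ℝ) × (Fin n → ℝ)) :=
    (l • ContinuousLinearMap.id ℝ (Fin n₁ → ℝ)).prodMap
      (l ^ 2 • ContinuousLinearMap.id ℝ (Fin n → ℝ))
  have hD : ∀ y, D y = dil2 l y := fun y => rfl
  have h1 : fderiv ℝ (fun y => F (dil2 l y)) z = (fderiv ℝ F (dil2 l z)).comp D := by
    have := (hF _ (dil2_eq_zero hl z hz)).hasFDerivAt
    exact (this.comp z (D.hasFDerivAt)).fderiv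
  have h2 : fderiv ℝ (fun y => F (dil2 l y)) z = l • fderiv ℝ F z := by
    simp only [hh l hl]
    exact fderiv_const_mul (hF z hz) l
  have h3 : D (vfld B j z) = l • vfld B j (dil2 l z) := by
    rw [hD]
    ext i
    · simp [vfld, dil2]
    · simp only [vfld, dil2, Prod.smul_snd, Pi.smul_apply, smul_eq_mul, Finset.mul_sum]
      refine Finset.sum_congr rfl fun i _ => ?_
      ring
  have h4 : (fderiv ℝ F (dil2 l z)) (D (vfld B j z)) = l * fderiv ℝ F z (vfld B j z) := by
    have := congrArg (fun T => T (vfld B j z)) (h1.symm.trans h2)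
    simpa using this
  rw [h3, map_smul, smul_eq_mul] at h4
  rw [Xvf_eq, Xvf_eq]
  exact mul_left_cancel₀ hl.ne' h4

lemma hom_zero_bounded {n₁ n : ℕ} (F : (Fin n₁ → ℝ) × (Fin n → ℝ) → ℝ)
    (hF : ContinuousOn F {(0 : (Fin n₁ → ℝ) × (Fin n → ℝ))}ᶜ)
    (hh : ∀ l : ℝ, 0 < l → ∀ z, z ≠ 0 → F (dil2 l z) = F z) :
    ∃ C : ℝ, 0 < C ∧ ∀ z, z ≠ 0 → |F z| ≤ C := by
  let ρ : (Fin n₁ → ℝ) × (Fin n → ℝ) → ℝ := fun z => max ‖z.1‖ (Real.sqrt ‖z.2‖)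
  have hρc : Continuous ρ := by fun_prop
  have hρh : ∀ l : ℝ, 0 < l → ∀ z, ρ (dil2 l z) = l * ρ z := by
    intro l hl z
    have e1 : ‖(dil2 l z).1‖ = l * ‖z.1‖ := by
      have : (dil2 l z).1 = l • z.1 := rfl
      rw [this, norm_smul, Real.norm_of_nonneg hl.le]
    have e2 : ‖(dil2 l z).2‖ = l ^ 2 * ‖z.2‖ := by
      have : (dil2 l z).2 = (l ^ 2) • z.2 := rfl
      rw [this, norm_smul, Real.norm_of_nonneg (by positivity)]
    simp only [ρ, e1, e2]
    rw [Real.sqrt_mul (by positivity), Real.sqrt_sq hl.le, mul_max_of_nonneg _ _ hl.le]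
  have hρpos : ∀ z, z ≠ 0 → 0 < ρ z := by
    intro z hz
    by_contra h
    push Not at h
    apply hz
    have h1 : ‖z.1‖ ≤ 0 := (le_max_left _ _).trans h
    have h2 : Real.sqrt ‖z.2‖ ≤ 0 := (le_max_right _ _).trans h
    have h3 : ‖z.2‖ ≤ 0 := Real.sqrt_eq_zero'.1 (le_antisymm h2 (Real.sqrt_nonneg _))
    exact Prod.ext (norm_le_zero_iff.1 h1) (norm_le_zero_iff.1 h3)
  have hcomp : IsCompact {z | ρ z = 1} := by
    refine Metric.isCompact_of_isClosed_isBounded (isClosed_eq hρc continuous_const) ?_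
    refine (Metric.isBounded_closedBall (x := (0 : (Fin n₁ → ℝ) × (Fin n → ℝ))) (r := 1)).subset ?_
    intro z hz
    have hz' : ρ z = 1 := hz
    rw [mem_closedBall_zero_iff, Prod.norm_def, max_le_iff]
    refine ⟨(le_max_left _ _).trans hz'.le, ?_⟩
    have := (le_max_right ‖z.1‖ (Real.sqrt ‖z.2‖)).trans hz'.le
    rwa [Real.sqrt_le_one] at this
  have hsub : {z | ρ z = 1} ⊆ {(0 : (Fin n₁ → ℝ) × (Fin n → ℝ))}ᶜ := by
    intro z hz h0
    have hz' : ρ z = 1 := hz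
    rw [Set.mem_singleton_iff.1 h0] at hz'
    simp [ρ] at hz'
  obtain ⟨C, hC⟩ := hcomp.exists_bound_of_continuousOn (hF.mono hsub)
  refine ⟨max C 1, by positivity, fun z hz => ?_⟩
  have hp := hρpos z hz
  have hy := hρh (ρ z)⁻¹ (inv_pos.2 hp) z
  rw [inv_mul_cancel₀ hp.ne'] at hy
  rw [← hh _ (inv_pos.2 hp) z hz]
  exact (hC _ hy).trans (le_max_left _ _)

lemma contDiffOn_Xvf {n₁ n : ℕ} (B : Fin n → Matrix (Fin n₁) (Fin n₁) ℝ) (j : Fin n₁)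
    (F : (Fin n₁ → ℝ) × (Fin n → ℝ) → ℝ)
    (hF : ContDiffOn ℝ (⊤ : ℕ∞) F {(0 : (Fin n₁ → ℝ) × (Fin n → ℝ))}ᶜ) :
    ContDiffOn ℝ (⊤ : ℕ∞) (Xvf B j F) {(0 : (Fin n₁ → ℝ) × (Fin n → ℝ))}ᶜ := by
  have h := hF.fderiv_of_isOpen (m := ((⊤ : ℕ∞) : WithTop ℕ∞)) isOpen_compl_singleton (by simp)
  have h2 : Xvf B j F = fun z => fderiv ℝ F z (vfld B j z) := funext (Xvf_eq B j F)
  rw [h2]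
  exact h.clm_apply (contDiff_vfld B j).contDiffOn

lemma cutoff_contDiff {n₁ n : ℕ} (N F : (Fin n₁ → ℝ) × (Fin n → ℝ) → ℝ) (hN : IsHomQuasiNorm2 N)
    (hsm : ContDiffOn ℝ (⊤ : ℕ∞) N {(0 : (Fin n₁ → ℝ) × (Fin n → ℝ))}ᶜ)
    (hF : ContDiffOn ℝ (⊤ : ℕ∞) F {(0 : (Fin n₁ → ℝ) × (Fin n → ℝ))}ᶜ) :
    ContDiff ℝ (⊤ : ℕ∞) (fun z => smoothTransition (N z - 1) * F z) := by
  rw [contDiff_iff_contDiffAt]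
  intro z
  by_cases hz : z = 0
  · have h0 : N z < 1 := by rw [(hN.2.2.1 z).2 hz]; norm_num
    have h1 : ∀ᶠ y in nhds z, N y < 1 := hN.1.continuousAt.eventually_lt_const h0
    have h2 : (fun z => smoothTransition (N z - 1) * F z) =ᶠ[nhds z] fun _ => 0 := by
      filter_upwards [h1] with y hy
      rw [smoothTransition.zero_of_nonpos (by linarith), zero_mul]
    exact contDiffAt_const.congr_of_eventuallyEq h2
  · have hm : ({(0 : (Fin n₁ → ℝ) × (Fin n → ℝ))}ᶜ : Set _) ∈ nhds z :=
      isOpen_compl_singleton.mem_nhds hz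
    have hNz := hsm.contDiffAt hm
    have hFz := hF.contDiffAt hm
    exact (smoothTransition.contDiff.contDiffAt.comp z (hNz.sub contDiffAt_const)).mul hFz

/-- The unregularised vector field `E_j = x² X_j N / N`. -/
noncomputable def Efld {n₁ n : ℕ} (B : Fin n → Matrix (Fin n₁) (Fin n₁) ℝ)
    (N : (Fin n₁ → ℝ) × (Fin n → ℝ) → ℝ) (j₀ j : Fin n₁)
    (z : (Fin n₁ → ℝ) × (Fin n → ℝ)) : ℝ := z.1 j₀ ^ 2 * Xvf B j N z / N z

/-- The cut-off vector field. -/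
noncomputable def Yfld {n₁ n : ℕ} (B : Fin n → Matrix (Fin n₁) (Fin n₁) ℝ)
    (N : (Fin n₁ → ℝ) × (Fin n → ℝ) → ℝ) (j₀ j : Fin n₁)
    (z : (Fin n₁ → ℝ) × (Fin n → ℝ)) : ℝ := smoothTransition (N z - 1) * Efld B N j₀ j z

lemma Efld_contDiffOn {n₁ n : ℕ} (B : Fin n → Matrix (Fin n₁) (Fin n₁) ℝ)
    (N : (Fin n₁ → ℝ) × (Fin n → ℝ) → ℝ) (hN : IsHomQuasiNorm2 N)
    (hsm : ContDiffOn ℝ (⊤ : ℕ∞) N {(0 : (Fin n₁ → ℝ) × (Fin n → ℝ))}ᶜ) (j₀ j : Fin n₁) :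
    ContDiffOn ℝ (⊤ : ℕ∞) (Efld B N j₀ j) {(0 : (Fin n₁ → ℝ) × (Fin n → ℝ))}ᶜ := by
  unfold Efld
  refine ContDiffOn.div (ContDiffOn.mul ?_ (contDiffOn_Xvf B j N hsm)) hsm ?_
  · exact ContDiff.contDiffOn (by fun_prop)
  · intro z hz h
    exact hz ((hN.2.2.1 z).1 h)

lemma diffAt_of_contDiffOn {n₁ n : ℕ} {F : (Fin n₁ → ℝ) × (Fin n → ℝ) → ℝ}
    (hF : ContDiffOn ℝ (⊤ : ℕ∞) F {(0 : (Fin n₁ → ℝ) × (Fin n → ℝ))}ᶜ)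
    (z : (Fin n₁ → ℝ) × (Fin n → ℝ)) (hz : z ≠ 0) : DifferentiableAt ℝ F z :=
  (hF.contDiffAt (isOpen_compl_singleton.mem_nhds hz)).differentiableAt (by simp)

lemma XN_bounded {n₁ n : ℕ} (B : Fin n → Matrix (Fin n₁) (Fin n₁) ℝ)
    (N : (Fin n₁ → ℝ) × (Fin n → ℝ) → ℝ) (hN : IsHomQuasiNorm2 N)
    (hsm : ContDiffOn ℝ (⊤ : ℕ∞) N {(0 : (Fin n₁ → ℝ) × (Fin n → ℝ))}ᶜ) :
    ∃ C : ℝ, 0 < C ∧ ∀ z, z ≠ 0 → gradLen B N z ≤ C := by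
  have h : ∃ C : ℝ, 0 < C ∧ ∀ z, z ≠ 0 → |gradLen B N z| ≤ C := by
    refine hom_zero_bounded _ ?_ ?_
    · unfold gradLen gradSq
      refine ContinuousOn.sqrt ?_
      exact continuousOn_finsetSum _ fun j _ => (contDiffOn_Xvf B j N hsm).continuousOn.pow 2
    · intro l hl z hz
      unfold gradLen gradSq
      congr 1
      refine Finset.sum_congr rfl fun j _ => ?_
      rw [Xvf_hom B j N (diffAt_of_contDiffOn hsm) hN.2.2.2 l hl z hz]
  obtain ⟨C, h0, h⟩ := h
  exact ⟨C, h0, fun z hz => (le_abs_self _).trans (h z hz)⟩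

lemma N_pos {n₁ n : ℕ} {N : (Fin n₁ → ℝ) × (Fin n → ℝ) → ℝ} (hN : IsHomQuasiNorm2 N)
    {z : (Fin n₁ → ℝ) × (Fin n → ℝ)} (hz : z ≠ 0) : 0 < N z :=
  lt_of_le_of_ne (hN.2.1 z) fun h => hz ((hN.2.2.1 z).1 h.symm)

lemma norm_fst_bounded {n₁ n : ℕ} (N : (Fin n₁ → ℝ) × (Fin n → ℝ) → ℝ) (hN : IsHomQuasiNorm2 N) :
    ∃ C : ℝ, 0 < C ∧ ∀ z, ‖z.1‖ ≤ C * N z := by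
  obtain ⟨C, hC0, hC⟩ := hom_zero_bounded (fun z => ‖z.1‖ / N z)
    (by
      refine ContinuousOn.div (by fun_prop) hN.1.continuousOn ?_
      intro z hz h
      exact hz ((hN.2.2.1 z).1 h))
    (by
      intro l hl z hz
      have : (dil2 l z).1 = l • z.1 := rfl
      simp only [this, hN.2.2.2 l hl, norm_smul, Real.norm_of_nonneg hl.le]
      rw [mul_div_mul_left _ _ hl.ne'])
  refine ⟨C, hC0, fun z => ?_⟩
  by_cases hz : z = 0
  · simp [hz, (hN.2.2.1 0).2 rfl]
  · have := (le_abs_self _).trans (hC z hz)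
    rwa [div_le_iff₀ (N_pos hN hz)] at this

lemma norm_snd_bounded {n₁ n : ℕ} (N : (Fin n₁ → ℝ) × (Fin n → ℝ) → ℝ) (hN : IsHomQuasiNorm2 N) :
    ∃ C : ℝ, 0 < C ∧ ∀ z, ‖z.2‖ ≤ C * N z ^ 2 := by
  obtain ⟨C, hC0, hC⟩ := hom_zero_bounded (fun z => ‖z.2‖ / N z ^ 2)
    (by
      refine ContinuousOn.div (by fun_prop) (hN.1.continuousOn.pow 2) ?_
      intro z hz h
      exact hz ((hN.2.2.1 z).1 (by simpa using h)))
    (by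
      intro l hl z hz
      have : (dil2 l z).2 = (l ^ 2) • z.2 := rfl
      have hl2 : 0 < l ^ 2 := by positivity
      simp only [this, hN.2.2.2 l hl, norm_smul, Real.norm_of_nonneg hl2.le, mul_pow]
      rw [mul_div_mul_left _ _ hl2.ne'])
  refine ⟨C, hC0, fun z => ?_⟩
  by_cases hz : z = 0
  · simp [hz, (hN.2.2.1 0).2 rfl]
  · have := (le_abs_self _).trans (hC z hz)
    have hp := N_pos hN hz
    rwa [div_le_iff₀ (by positivity)] at this

lemma sublevel_compact {n₁ n : ℕ} (N : (Fin n₁ → ℝ) × (Fin n → ℝ) → ℝ) (hN : IsHomQuasiNorm2 N) :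
    IsCompact {z | N z ≤ 2} := by
  obtain ⟨C, hC0, hC⟩ := norm_fst_bounded N hN
  obtain ⟨D, hD0, hD⟩ := norm_snd_bounded N hN
  refine Metric.isCompact_of_isClosed_isBounded (isClosed_le hN.1 continuous_const) ?_
  refine (Metric.isBounded_closedBall (x := (0 : (Fin n₁ → ℝ) × (Fin n → ℝ)))
    (r := max (C * 2) (D * 2 ^ 2))).subset ?_
  intro z hz
  have hz' : N z ≤ 2 := hz
  have h0 := hN.2.1 z
  rw [mem_closedBall_zero_iff, Prod.norm_def]
  refine max_le_max ((hC z).trans ?_) ((hD z).trans ?_) <;> gcongr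

lemma XY_bounded {n₁ n : ℕ} (B : Fin n → Matrix (Fin n₁) (Fin n₁) ℝ)
    (N : (Fin n₁ → ℝ) × (Fin n → ℝ) → ℝ) (hN : IsHomQuasiNorm2 N)
    (hsm : ContDiffOn ℝ (⊤ : ℕ∞) N {(0 : (Fin n₁ → ℝ) × (Fin n → ℝ))}ᶜ) (j₀ j : Fin n₁) :
    ∃ C : ℝ, 0 < C ∧ ∀ z, |Xvf B j (Yfld B N j₀ j) z| ≤ C := by
  have hE := Efld_contDiffOn B N hN hsm j₀ j
  have hY : ContDiff ℝ (⊤ : ℕ∞) (Yfld B N j₀ j) := cutoff_contDiff N _ hN hsm hE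
  have hXE := contDiffOn_Xvf B j _ hE
  obtain ⟨C, hC0, hC⟩ := hom_zero_bounded _ hXE.continuousOn
    (Xvf_hom B j _ (diffAt_of_contDiffOn hE) (by
      intro l hl z
      by_cases hz : z = 0
      · subst hz
        have : dil2 l (0 : (Fin n₁ → ℝ) × (Fin n → ℝ)) = 0 := by ext i <;> simp [dil2]
        rw [this]
        simp [Efld]
      · unfold Efld
        rw [Xvf_hom B j N (diffAt_of_contDiffOn hsm) hN.2.2.2 l hl z hz, hN.2.2.2 l hl]
        have hp := N_pos hN hz
        simp only [dil2]
        field_simp))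
  have hXY : Continuous (Xvf B j (Yfld B N j₀ j)) := by
    have := (contDiffOn_Xvf B j _ hY.contDiffOn)
    have h2 : Xvf B j (Yfld B N j₀ j) = fun z => fderiv ℝ (Yfld B N j₀ j) z (vfld B j z) :=
      funext (Xvf_eq B j _)
    rw [h2]
    exact (hY.continuous_fderiv (by simp)).clm_apply (contDiff_vfld B j).continuous
  obtain ⟨D, hD⟩ := (sublevel_compact N hN).exists_bound_of_continuousOn hXY.continuousOn
  refine ⟨max C D, lt_max_of_lt_left hC0, fun z => ?_⟩
  by_cases hz : N z ≤ 2
  · exact (hD z hz).trans (le_max_right _ _)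
  · push Not at hz
    have hz0 : z ≠ 0 := by
      rintro rfl
      rw [(hN.2.2.1 0).2 rfl] at hz
      linarith
    have h1 : ∀ᶠ y in nhds z, 2 < N y := hN.1.continuousAt.eventually_const_lt hz
    have h2 : Yfld B N j₀ j =ᶠ[nhds z] Efld B N j₀ j := by
      filter_upwards [h1] with y hy
      rw [Yfld, smoothTransition.one_of_one_le (by linarith), one_mul]
    rw [Xvf_congr B j h2]
    exact (hC z hz0).trans (le_max_left _ _)

lemma real_bound_Y {x M K K1 g θ p : ℝ} {γ : ℕ} (hx : 0 ≤ x) (hM : 0 < M) (hK : 0 < K)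
    (hxK : x ≤ K * M) (hg : 0 ≤ g) (hg1 : g ≤ K1) (h0 : 0 ≤ θ) (h1 : θ ≤ 1)
    (hγ : 2 ≤ γ) (hp : 2 * (γ : ℝ) ≤ p) :
    (θ * (x ^ 2 / M) * g) ^ p ≤
      K1 ^ p * K ^ (2 * p - 2 * (γ : ℝ)) * (M ^ (p - 2 * (γ : ℝ)) * x ^ (2 * γ)) := by
  have hγ' : (2 : ℝ) ≤ γ := by exact_mod_cast hγ
  have hK1 : 0 ≤ K1 := hg.trans hg1
  have hp0 : 0 < p := by linarith
  rcases hx.eq_or_lt with rfl | hx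
  · simp only [ne_eq, OfNat.ofNat_ne_zero, not_false_eq_true, zero_pow, zero_div, mul_zero,
      zero_mul]
    rw [Real.zero_rpow hp0.ne']
    positivity
  calc (θ * (x ^ 2 / M) * g) ^ p ≤ (1 * (x ^ 2 / M) * K1) ^ p := by gcongr
    _ = K1 ^ p * (x ^ (2 * p - 2 * (γ : ℝ)) * x ^ (2 * γ)) / M ^ p := by
      rw [one_mul, Real.mul_rpow (by positivity) hK1, Real.div_rpow (by positivity) hM.le,
        ← Real.rpow_natCast x (2 * γ), ← Real.rpow_add hx, ← Real.rpow_natCast x 2,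
        ← Real.rpow_mul hx.le]
      push_cast
      ring_nf
    _ ≤ K1 ^ p * ((K * M) ^ (2 * p - 2 * (γ : ℝ)) * x ^ (2 * γ)) / M ^ p := by
      gcongr
      linarith
    _ = _ := by
      rw [Real.mul_rpow hK.le hM.le]
      have : M ^ (2 * p - 2 * (γ : ℝ)) = M ^ (p - 2 * (γ : ℝ)) * M ^ p := by
        rw [← Real.rpow_add hM]; ring_nf
      rw [this]
      have : M ^ p ≠ 0 := (Real.rpow_pos_of_pos hM p).ne'
      field_simp

lemma real_bound_V {x M c g p : ℝ} {γ : ℕ} (hx : 0 ≤ x) (hM : 0 < M) (hc : 0 < c)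
    (hg : c * x ^ (γ - 1) / M ^ (γ - 1) ≤ g) (hγ : 2 ≤ γ) :
    c ^ 2 * (M ^ (p - 2 * (γ : ℝ)) * x ^ (2 * γ)) ≤ M ^ (p - 1) * (x ^ 2 / M) * g ^ 2 := by
  obtain ⟨m, rfl⟩ : ∃ m, γ = m + 1 := ⟨γ - 1, by omega⟩
  simp only [Nat.add_sub_cancel] at hg
  calc c ^ 2 * (M ^ (p - 2 * ((m + 1 : ℕ) : ℝ)) * x ^ (2 * (m + 1)))
      = M ^ (p - 1) * (x ^ 2 / M) * (c * x ^ m / M ^ m) ^ 2 := by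
        have : M ^ (p - 1) = M ^ (p - 2 * ((m + 1 : ℕ) : ℝ)) * M ^ (2 * m + 1) := by
          rw [← Real.rpow_natCast M (2 * m + 1), ← Real.rpow_add hM]
          push_cast
          ring_nf
        rw [this]
        field_simp
        ring
    _ ≤ _ := by gcongr

lemma young_tau {a b p q τ : ℝ} (ha : 0 ≤ a) (hb : 0 ≤ b) (hτ : 0 < τ)
    (hpq : p.HolderConjugate q) : a * b ≤ τ ^ p * a ^ p + (τ⁻¹) ^ q * b ^ q := by
  have h := Real.young_inequality_of_nonneg (a := τ * a) (b := τ⁻¹ * b) (by positivity)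
    (by positivity) hpq
  have e : τ * a * (τ⁻¹ * b) = a * b := by field_simp
  rw [e, Real.mul_rpow hτ.le ha, Real.mul_rpow (by positivity) hb] at h
  have h1 : τ ^ p * a ^ p / p ≤ τ ^ p * a ^ p := div_le_self (by positivity) hpq.lt.le
  have h2 : (τ⁻¹) ^ q * b ^ q / q ≤ (τ⁻¹) ^ q * b ^ q :=
    div_le_self (by positivity) hpq.symm.lt.le
  linarith

lemma abs_sum_X_le {n₁ n : ℕ} (B : Fin n → Matrix (Fin n₁) (Fin n₁) ℝ)
    (f g : (Fin n₁ → ℝ) × (Fin n → ℝ) → ℝ) (z : (Fin n₁ → ℝ) × (Fin n → ℝ)) :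
    |∑ j, Xvf B j f z * Xvf B j g z| ≤ gradLen B f z * gradLen B g z := by
  unfold gradLen gradSq
  rw [← Real.sqrt_mul (Finset.sum_nonneg fun j _ => sq_nonneg _)]
  exact Real.abs_le_sqrt (Finset.sum_mul_sq_le_sq_mul_sq _ _ _)

lemma abs_X_le {n₁ n : ℕ} (B : Fin n → Matrix (Fin n₁) (Fin n₁) ℝ) (j : Fin n₁)
    (f : (Fin n₁ → ℝ) × (Fin n → ℝ) → ℝ) (z : (Fin n₁ → ℝ) × (Fin n → ℝ)) :
    |Xvf B j f z| ≤ gradLen B f z := by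
  unfold gradLen gradSq
  exact Real.abs_le_sqrt (Finset.single_le_sum (f := fun j => (Xvf B j f z) ^ 2)
    (fun j _ => sq_nonneg _) (Finset.mem_univ j))

lemma abs_rpow_aux (x : ℝ) {q : ℝ} (hq : 1 < q) : |x| ^ (q - 2) * |x| = |x| ^ (q - 1) := by
  by_cases hx : x = 0
  · simp only [hx, abs_zero, mul_zero]
    rw [Real.zero_rpow (by linarith)]
  · have : 0 < |x| := abs_pos.2 hx
    rw [← Real.rpow_add_one this.ne']
    ring_nf

/-- The test vector fields entering the integration by parts. -/
noncomputable def ufld {n₁ n : ℕ} (B : Fin n → Matrix (Fin n₁) (Fin n₁) ℝ)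
    (N : (Fin n₁ → ℝ) × (Fin n → ℝ) → ℝ) (j₀ : Fin n₁) (a p q : ℝ)
    (W f : (Fin n₁ → ℝ) × (Fin n → ℝ) → ℝ) (j : Fin n₁)
    (z : (Fin n₁ → ℝ) × (Fin n → ℝ)) : ℝ :=
  |f z| ^ q * (Yfld B N j₀ j z * Real.exp (-(a * N z ^ p))) * Real.exp (-W z)

lemma ufld_zero {n₁ n : ℕ} (B : Fin n → Matrix (Fin n₁) (Fin n₁) ℝ)
    (N : (Fin n₁ → ℝ) × (Fin n → ℝ) → ℝ) (hN : IsHomQuasiNorm2 N) (j₀ : Fin n₁) (a p q : ℝ)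
    (W f : (Fin n₁ → ℝ) × (Fin n → ℝ) → ℝ) (j : Fin n₁) :
    Xvf B j (ufld B N j₀ a p q W f j) 0 = 0 := by
  have h0 : N 0 < 1 := by rw [(hN.2.2.1 0).2 rfl]; norm_num
  have h1 : ∀ᶠ y in nhds 0, N y < 1 := hN.1.continuousAt.eventually_lt_const h0
  have h2 : ufld B N j₀ a p q W f j =ᶠ[nhds 0] fun _ => 0 := by
    filter_upwards [h1] with y hy
    rw [ufld, Yfld, smoothTransition.zero_of_nonpos (by linarith)]
    simp
  rw [Xvf_congr B j h2, Xvf_eq]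
  simp

lemma ufld_X {n₁ n : ℕ} (B : Fin n → Matrix (Fin n₁) (Fin n₁) ℝ)
    (N : (Fin n₁ → ℝ) × (Fin n → ℝ) → ℝ) (hN : IsHomQuasiNorm2 N)
    (hsm : ContDiffOn ℝ (⊤ : ℕ∞) N {(0 : (Fin n₁ → ℝ) × (Fin n → ℝ))}ᶜ)
    (j₀ : Fin n₁) (a p q : ℝ) (hq1 : 1 < q)
    (W f : (Fin n₁ → ℝ) × (Fin n → ℝ) → ℝ) (hW : Differentiable ℝ W) (hf : Differentiable ℝ f)
    (j : Fin n₁) (z : (Fin n₁ → ℝ) × (Fin n → ℝ)) (hz : z ≠ 0) :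
    Xvf B j (ufld B N j₀ a p q W f j) z =
      Real.exp (-(a * N z ^ p)) * Real.exp (-W z) *
        (|f z| ^ q * Xvf B j (Yfld B N j₀ j) z
          + (smoothTransition (N z - 1) * (z.1 j₀ ^ 2 / N z)) *
            (q * |f z| ^ (q - 2) * f z * (Xvf B j N z * Xvf B j f z)
            - |f z| ^ q * (a * p * N z ^ (p - 1)) * Xvf B j N z ^ 2
            - |f z| ^ q * (Xvf B j N z * Xvf B j W z))) := by
  have hNp := N_pos hN hz
  have dN := diffAt_of_contDiffOn hsm z hz
  have dY : DifferentiableAt ℝ (Yfld B N j₀ j) z :=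
    (cutoff_contDiff N _ hN hsm (Efld_contDiffOn B N hN hsm j₀ j)).differentiable (by simp) z
  have hV : HasDerivAt (fun t : ℝ => Real.exp (-(a * t ^ p)))
      (Real.exp (-(a * N z ^ p)) * (-(a * (p * N z ^ (p - 1))))) (N z) :=
    (((Real.hasDerivAt_rpow_const (Or.inl hNp.ne')).const_mul a).neg).exp
  have hE : HasDerivAt (fun t : ℝ => Real.exp (-t)) (Real.exp (-W z) * (-1)) (W z) :=
    ((hasDerivAt_id (W z)).neg).exp
  have hA := hasDerivAt_abs_rpow (f z) hq1
  have dV : DifferentiableAt ℝ (fun z => Real.exp (-(a * N z ^ p))) z :=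
    (hV.comp_hasFDerivAt z dN.hasFDerivAt).differentiableAt
  have dE : DifferentiableAt ℝ (fun z => Real.exp (-W z)) z :=
    (hE.comp_hasFDerivAt z (hW z).hasFDerivAt).differentiableAt
  have dA : DifferentiableAt ℝ (fun z => |f z| ^ q) z :=
    (hA.comp_hasFDerivAt z (hf z).hasFDerivAt).differentiableAt
  unfold ufld
  rw [Xvf_mul B j (dA.fun_mul (dY.fun_mul dV)) dE, Xvf_mul B j dA (dY.fun_mul dV), Xvf_mul B j dY dV,
    Xvf_comp B j hV dN, Xvf_comp B j hE (hW z), Xvf_comp B j hA (hf z)]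
  have : Yfld B N j₀ j z = (smoothTransition (N z - 1) * (z.1 j₀ ^ 2 / N z)) * Xvf B j N z := by
    rw [Yfld, Efld]; ring
  rw [this]
  ring

lemma ufld_regular {n₁ n : ℕ} (B : Fin n → Matrix (Fin n₁) (Fin n₁) ℝ)
    (hskew : ∀ k, (B k)ᵀ = -(B k))
    (N : (Fin n₁ → ℝ) × (Fin n → ℝ) → ℝ) (hN : IsHomQuasiNorm2 N)
    (hsm : ContDiffOn ℝ (⊤ : ℕ∞) N {(0 : (Fin n₁ → ℝ) × (Fin n → ℝ))}ᶜ)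
    (j₀ : Fin n₁) (a p q : ℝ) (hq1 : 1 < q)
    (W f : (Fin n₁ → ℝ) × (Fin n → ℝ) → ℝ) (hW : Differentiable ℝ W)
    (M : (Fin n₁ → ℝ) × (Fin n → ℝ) → ℝ) (hM : Continuous M)
    (hWM : ∀ z, gradLen B W z ^ q ≤ M z)
    (hf : ContDiff ℝ (⊤ : ℕ∞) f) (hfc : HasCompactSupport f) (j : Fin n₁) :
    Integrable (Xvf B j (ufld B N j₀ a p q W f j)) ∧
      ∫ z, Xvf B j (ufld B N j₀ a p q W f j) z = 0 := by
  have hE := Efld_contDiffOn B N hN hsm j₀ j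
  have hEV : ContDiffOn ℝ (⊤ : ℕ∞) (fun z => Efld B N j₀ j z * Real.exp (-(a * N z ^ p)))
      {(0 : (Fin n₁ → ℝ) × (Fin n → ℝ))}ᶜ := by
    refine hE.mul (ContDiffOn.exp (ContDiffOn.neg (contDiffOn_const.mul ?_)))
    exact hsm.rpow_const_of_ne fun z hz => (N_pos hN hz).ne'
  have hQ := (cutoff_contDiff N _ hN hsm hEV).of_le (m := 1) (by simp)
  have hA : ContDiff ℝ 1 (fun z => |f z| ^ q) := (hf.of_le (m := 1) (by simp)).norm_rpow hq1
  set P : (Fin n₁ → ℝ) × (Fin n → ℝ) → ℝ := fun z =>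
    |f z| ^ q * (smoothTransition (N z - 1) * (Efld B N j₀ j z * Real.exp (-(a * N z ^ p)))) with hP
  have hPc : ContDiff ℝ 1 P := hA.mul hQ
  have hu : ufld B N j₀ a p q W f j = fun z => P z * Real.exp (-W z) := by
    funext z
    simp only [ufld, hP, Yfld]
    ring
  have hEd : Differentiable ℝ (fun z => Real.exp (-W z)) := hW.neg.exp
  have hPd : Differentiable ℝ P := hPc.differentiable (by simp)
  have hXPc : Continuous (Xvf B j P) := by
    have h2 : Xvf B j P = fun z => fderiv ℝ P z (vfld B j z) := funext (Xvf_eq B j _)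
    rw [h2]
    exact (hPc.continuous_fderiv (by simp)).clm_apply (contDiff_vfld B j).continuous
  have hP0 : ∀ z, z ∉ tsupport f → P =ᶠ[nhds z] fun _ => 0 := by
    intro z hz
    have := notMem_tsupport_iff_eventuallyEq.1 hz
    filter_upwards [this] with y hy
    simp only [hP, hy, Pi.zero_apply, abs_zero]
    rw [Real.zero_rpow (by linarith), zero_mul]
  have hXP0 : ∀ z, z ∉ tsupport f → Xvf B j P z = 0 := by
    intro z hz
    rw [Xvf_congr B j (hP0 z hz), Xvf_eq]
    simp
  let R : (Fin n₁ → ℝ) × (Fin n → ℝ) → ℝ := fun z =>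
    |P z| * (Real.exp (-W z) * (M z) ^ (q⁻¹)) + Real.exp (-W z) * |Xvf B j P z|
  have hRc : Continuous R := by
    have h1 := hPd.continuous
    have h2 := hEd.continuous
    have h3 : Continuous fun z => (M z) ^ (q⁻¹) :=
      hM.rpow_const fun z => Or.inr (by have : 0 < q := by linarith
                                        positivity)
    fun_prop
  have hRs : HasCompactSupport R := by
    refine HasCompactSupport.intro hfc fun z hz => ?_
    simp only [R, hXP0 z hz, (hP0 z hz).eq_of_nhds]
    simp
  obtain ⟨C, hC⟩ := hRc.bounded_above_of_compact_support hRs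
  rw [hu]
  refine Xvf_integral_zero B hskew j _ (hPd.mul hEd) ?_ C ?_
  · refine HasCompactSupport.intro hfc fun z hz => ?_
    simp [(hP0 z hz).eq_of_nhds]
  · intro z
    refine le_trans ?_ ((le_abs_self _).trans (hC z))
    have hE : HasDerivAt (fun t : ℝ => Real.exp (-t)) (Real.exp (-W z) * (-1)) (W z) :=
      ((hasDerivAt_id (W z)).neg).exp
    rw [Xvf_mul B j (hPd z) (hEd z), Xvf_comp B j hE (hW z)]
    have hg0 : 0 ≤ gradLen B W z := Real.sqrt_nonneg _
    have hb : |Xvf B j W z| ≤ (M z) ^ (q⁻¹) := by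
      refine (abs_X_le B j W z).trans ?_
      have h5 : gradLen B W z = (gradLen B W z ^ q) ^ (q⁻¹) := by
        rw [Real.rpow_rpow_inv hg0 (by linarith)]
      rw [h5]
      exact Real.rpow_le_rpow (by positivity) (hWM z) (by have : 0 < q := by linarith
                                                          positivity)
    refine (abs_add_le _ _).trans ?_
    simp only [abs_mul, abs_neg, abs_one, mul_one, Real.abs_exp, R]
    gcongr

lemma integral_muW {n₁ n : ℕ} (N : (Fin n₁ → ℝ) × (Fin n → ℝ) → ℝ) (hN : Continuous N)
    (a p : ℝ) (hp : 0 ≤ p) (W : (Fin n₁ → ℝ) × (Fin n → ℝ) → ℝ) (hW : Continuous W) :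
    ∃ k : ℝ, 0 ≤ k ∧ ∀ h : (Fin n₁ → ℝ) × (Fin n → ℝ) → ℝ,
      ∫ z, h z ∂(muW N a p W) =
        k * ∫ z, Real.exp (-(a * N z ^ p)) * Real.exp (-W z) * h z := by
  refine ⟨((∫⁻ z, ENNReal.ofReal (Real.exp (-W z)) ∂(muP N a p))⁻¹).toReal *
    ((∫⁻ z, ENNReal.ofReal (Real.exp (-(a * N z ^ p))))⁻¹).toReal, by positivity, fun h => ?_⟩
  have hV : Continuous fun z => Real.exp (-(a * N z ^ p)) := by
    have := hN.rpow_const (p := p) fun z => Or.inr hp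
    fun_prop
  have hE : Continuous fun z => Real.exp (-W z) := by fun_prop
  rw [muW, integral_smul_measure,
    integral_withDensity_eq_integral_toReal_smul (by fun_prop) (by simp), muP,
    integral_smul_measure,
    integral_withDensity_eq_integral_toReal_smul (by fun_prop) (by simp)]
  simp only [smul_eq_mul, ENNReal.toReal_ofReal (Real.exp_nonneg _)]
  rw [mul_assoc]
  simp only [mul_assoc]

set_option maxHeartbeats 800000 in
lemma pointwise_bound {n₁ n : ℕ} (B : Fin n → Matrix (Fin n₁) (Fin n₁) ℝ)
    (N : (Fin n₁ → ℝ) × (Fin n → ℝ) → ℝ) (hN : IsHomQuasiNorm2 N)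
    (hsm : ContDiffOn ℝ (⊤ : ℕ∞) N {(0 : (Fin n₁ → ℝ) × (Fin n → ℝ))}ᶜ)
    (j₀ : Fin n₁) (γ : ℕ) (hγ : 2 ≤ γ) (c : ℝ) (hc : 0 < c)
    (hG : ∀ z : (Fin n₁ → ℝ) × (Fin n → ℝ), z ≠ 0 →
      c * |z.1 j₀| ^ (γ - 1) / N z ^ (γ - 1) ≤ gradLen B N z)
    (a p q : ℝ) (ha : 0 < a) (hp : 2 * (γ : ℝ) ≤ p) (hpq : p.HolderConjugate q)
    (K K1 CY τ : ℝ) (hK : 0 < K) (hτ : 0 < τ) (hCY : 0 < CY)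
    (hxK : ∀ z, |z.1 j₀| ≤ K * N z) (hK1 : ∀ z, z ≠ 0 → gradLen B N z ≤ K1)
    (hXY : ∀ z, |∑ j, Xvf B j (Yfld B N j₀ j) z| ≤ CY)
    (W f : (Fin n₁ → ℝ) × (Fin n → ℝ) → ℝ) (hW : Differentiable ℝ W) (hf : Differentiable ℝ f)
    (δ γδ : ℝ) (hγδ : 0 < γδ)
    (hWb : ∀ z : (Fin n₁ → ℝ) × (Fin n → ℝ),
      gradLen B W z ^ q ≤ δ * (N z ^ (p - 2 * (γ : ℝ)) * |z.1 j₀| ^ (2 * γ)) + γδ)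
    (hτ2 : 4 * (τ ^ p * (K1 ^ p * K ^ (2 * p - 2 * (γ : ℝ)))) ≤ a * p * c ^ 2)
    (hδ2 : 4 * ((τ⁻¹) ^ q * δ) ≤ a * p * c ^ 2)
    (z : (Fin n₁ → ℝ) × (Fin n → ℝ)) :
    ∑ j, Xvf B j (ufld B N j₀ a p q W f j) z ≤
      Real.exp (-(a * N z ^ p)) * Real.exp (-W z) *
        ((τ⁻¹) ^ q * q ^ q * gradLen B f z ^ q
          + (CY + a * p * c ^ 2 * (2 ^ (p - 2 * (γ : ℝ)) * (K * 2) ^ (2 * γ)) + (τ⁻¹) ^ q * γδ) *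
            |f z| ^ q
          - a * p * c ^ 2 / 4 *
            (|f z| ^ q * N z ^ (p - 2 * (γ : ℝ)) * |z.1 j₀| ^ (2 * γ))) := by
  have hq1 : 1 < q := hpq.symm.lt
  have hp1 : 1 < p := hpq.lt
  have hp0 : 0 < p := by linarith
  have hq0 : 0 < q := by linarith
  by_cases hz : z = 0
  · subst hz
    simp only [ufld_zero B N hN, Finset.sum_const_zero]
    have hx0 : |(0 : (Fin n₁ → ℝ) × (Fin n → ℝ)).1 j₀| ^ (2 * γ) = 0 := by
      have : 2 * γ ≠ 0 := by omega
      simp [this]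
    rw [hx0, mul_zero, mul_zero, sub_zero]
    have : 0 ≤ gradLen B f 0 := Real.sqrt_nonneg _
    positivity
  have hNp := N_pos hN hz
  simp only [ufld_X B N hN hsm j₀ a p q hq1 W f hW hf _ z hz]
  rw [← Finset.mul_sum]
  refine mul_le_mul_of_nonneg_left ?_ (by positivity)
  simp only [Finset.sum_add_distrib, Finset.sum_sub_distrib, ← Finset.mul_sum]
  have hsq : ∑ j, Xvf B j N z ^ 2 = gradLen B N z ^ 2 := by
    unfold gradLen gradSq
    rw [Real.sq_sqrt (Finset.sum_nonneg fun j _ => sq_nonneg _)]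
  rw [hsq]
  set g := |f z| ^ q with hg
  have hg0 : 0 ≤ g := by positivity
  set θ := smoothTransition (N z - 1) with hθ
  have hθ0 : 0 ≤ θ := smoothTransition.nonneg _
  have hθ1 : θ ≤ 1 := smoothTransition.le_one _
  set w := N z ^ (p - 2 * (γ : ℝ)) * |z.1 j₀| ^ (2 * γ) with hw
  have hw0 : 0 ≤ w := by positivity
  have hgN0 : 0 ≤ gradLen B N z := Real.sqrt_nonneg _
  have hgf0 : 0 ≤ gradLen B f z := Real.sqrt_nonneg _
  have hgW0 : 0 ≤ gradLen B W z := Real.sqrt_nonneg _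
  rw [← sq_abs (z.1 j₀)]
  have hY := real_bound_Y (abs_nonneg (z.1 j₀)) hNp hK (hxK z) hgN0 (hK1 z hz) hθ0 hθ1 hγ hp
  have hV := real_bound_V (p := p) (abs_nonneg (z.1 j₀)) hNp hc (hG z hz) hγ
  rw [← hw] at hY hV
  set s := θ * (|z.1 j₀| ^ 2 / N z) with hs
  have hs0 : 0 ≤ s := by positivity
  set K2 := K1 ^ p * K ^ (2 * p - 2 * (γ : ℝ)) with hK2
  clear_value s K2 g
  -- the divergence term
  have t1 : g * ∑ j, Xvf B j (Yfld B N j₀ j) z ≤ g * CY :=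
    mul_le_mul_of_nonneg_left ((le_abs_self _).trans (hXY z)) hg0
  -- the gradient term
  have t2 : s * (q * |f z| ^ (q - 2) * f z * ∑ j, Xvf B j N z * Xvf B j f z) ≤
      τ ^ p * (K2 * w) * g + (τ⁻¹) ^ q * q ^ q * gradLen B f z ^ q := by
    have h1 : s * (q * |f z| ^ (q - 2) * f z * ∑ j, Xvf B j N z * Xvf B j f z) ≤
        (|f z| ^ (q - 1) * (s * gradLen B N z)) * (q * gradLen B f z) := by
      refine (le_abs_self _).trans ?_
      rw [← abs_rpow_aux _ hq1]
      simp only [abs_mul]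
      rw [abs_of_nonneg hs0, abs_of_nonneg hq0.le,
        abs_of_nonneg (a := |f z| ^ (q - 2)) (by positivity)]
      have := abs_sum_X_le B N f z
      calc s * (q * |f z| ^ (q - 2) * |f z| * |∑ j, Xvf B j N z * Xvf B j f z|)
          ≤ s * (q * |f z| ^ (q - 2) * |f z| * (gradLen B N z * gradLen B f z)) := by gcongr
        _ = _ := by ring
    refine h1.trans ((young_tau (by positivity) (by positivity) hτ hpq).trans ?_)
    rw [Real.mul_rpow (by positivity) (by positivity), ← Real.rpow_mul (abs_nonneg _),
      Real.mul_rpow hq0.le hgf0]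
    have e : (q - 1) * p = q := by
      have := hpq.symm.sub_one_mul_conj
      linarith
    rw [e, ← hg]
    have : τ ^ p * (g * (s * gradLen B N z) ^ p) ≤ τ ^ p * (g * (K2 * w)) := by gcongr
    linarith
  -- the perturbation term
  have t3 : -(s * (g * ∑ j, Xvf B j N z * Xvf B j W z)) ≤
      g * (τ ^ p * (K2 * w) + (τ⁻¹) ^ q * (δ * w + γδ)) := by
    have h1 : -(s * (g * ∑ j, Xvf B j N z * Xvf B j W z)) ≤
        g * ((s * gradLen B N z) * gradLen B W z) := by
      refine (neg_le_abs _).trans ?_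
      rw [abs_mul, abs_mul, abs_of_nonneg hs0, abs_of_nonneg hg0]
      have := abs_sum_X_le B N W z
      calc s * (g * |∑ j, Xvf B j N z * Xvf B j W z|)
          ≤ s * (g * (gradLen B N z * gradLen B W z)) := by gcongr
        _ = _ := by ring
    refine h1.trans (mul_le_mul_of_nonneg_left ?_ hg0)
    refine (young_tau (by positivity) hgW0 hτ hpq).trans ?_
    have := hWb z
    gcongr
  -- the main term
  have t4 : a * p * c ^ 2 * (w - 2 ^ (p - 2 * (γ : ℝ)) * (K * 2) ^ (2 * γ)) ≤
      s * ((a * p * N z ^ (p - 1)) * gradLen B N z ^ 2) := by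
    have h1 : a * p * (θ * (c ^ 2 * w)) ≤
        s * ((a * p * N z ^ (p - 1)) * gradLen B N z ^ 2) := by
      calc a * p * (θ * (c ^ 2 * w)) ≤
          a * p * (θ * (N z ^ (p - 1) * (|z.1 j₀| ^ 2 / N z) * gradLen B N z ^ 2)) := by gcongr
        _ = _ := by rw [hs]; ring
    refine le_trans ?_ h1
    have h2 : w - 2 ^ (p - 2 * (γ : ℝ)) * (K * 2) ^ (2 * γ) ≤ θ * w := by
      by_cases h : 2 ≤ N z
      · have : θ = 1 := smoothTransition.one_of_one_le (by linarith)
        rw [this, one_mul]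
        have : 0 ≤ (2 : ℝ) ^ (p - 2 * (γ : ℝ)) * (K * 2) ^ (2 * γ) := by positivity
        linarith
      · push Not at h
        have h3 : w ≤ 2 ^ (p - 2 * (γ : ℝ)) * (K * 2) ^ (2 * γ) := by
          have h4 : |z.1 j₀| ≤ K * 2 := (hxK z).trans (by gcongr)
          have h5 : 0 ≤ p - 2 * (γ : ℝ) := by linarith
          rw [hw]
          gcongr
        have : 0 ≤ θ * w := by positivity
        linarith
    calc _ ≤ a * p * c ^ 2 * (θ * w) := by gcongr
      _ = _ := by ring
  have t4' := mul_le_mul_of_nonneg_left t4 hg0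
  have hgw : 0 ≤ g * w := by positivity
  have t5 := mul_le_mul_of_nonneg_right hτ2 hgw
  have t6 := mul_le_mul_of_nonneg_right hδ2 hgw
  have e2 : g * N z ^ (p - 2 * (γ : ℝ)) * |z.1 j₀| ^ (2 * γ) = g * w := by rw [hw]; ring
  rw [e2]
  linarith [t1, t2, t3, t4', t5, t6]

/-- U-bound for perturbed measures (Corollary 3.8 of the paper, on step-2 groups): there is
`δ₀ > 0` such that whenever the differentiable potential `W` satisfies
`|∇_G W|^q ≤ δ N^{p−2γ}|x_{j₀}|^{2γ} + γ_δ` with `0 < δ < δ₀`, `γ_δ > 0`, and `e^{−W}` is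
`μ_p`-integrable, the normalized measure `μ_W = Ẑ⁻¹ e^{−W} dμ_p` satisfies the U-bound
`∫ |f|^q N^{p−2γ}|x_{j₀}|^{2γ} dμ_W ≤ A' ∫ |∇_G f|^q dμ_W + B' ∫ |f|^q dμ_W`
for all smooth compactly supported `f`. -/
theorem Ubound_perturbed_step2
    (n₁ n : ℕ) (hn₁ : 0 < n₁) (hn : 0 < n)
    (B : Fin n → Matrix (Fin n₁) (Fin n₁) ℝ)
    (hskew : ∀ k, (B k)ᵀ = -(B k))
    (hindep : ∀ τ : Fin n → ℝ, ∑ k, τ k • B k = 0 → τ = 0)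
    (N : (Fin n₁ → ℝ) × (Fin n → ℝ) → ℝ) (hN : IsHomQuasiNorm2 N)
    (hsm : ContDiffOn ℝ (⊤ : ℕ∞) N {(0 : (Fin n₁ → ℝ) × (Fin n → ℝ))}ᶜ)
    (j₀ : Fin n₁) (γ : ℕ) (hγ : 2 ≤ γ) (c : ℝ) (hc : 0 < c)
    (hG : ∀ z : (Fin n₁ → ℝ) × (Fin n → ℝ), z ≠ 0 →
      c * |z.1 j₀| ^ (γ - 1) / N z ^ (γ - 1) ≤ gradLen B N z)
    (a p q : ℝ) (ha : 0 < a) (hp : 2 * (γ : ℝ) ≤ p) (hq : q = p / (p - 1)) :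
    ∃ δ₀ : ℝ, 0 < δ₀ ∧
      ∀ W : (Fin n₁ → ℝ) × (Fin n → ℝ) → ℝ, Differentiable ℝ W →
        ∀ δ γδ : ℝ, 0 < δ → δ < δ₀ → 0 < γδ →
        (∀ z : (Fin n₁ → ℝ) × (Fin n → ℝ),
          gradLen B W z ^ q ≤ δ * (N z ^ (p - 2 * (γ : ℝ)) * |z.1 j₀| ^ (2 * γ)) + γδ) →
        Integrable (fun z => Real.exp (-W z)) (muP N a p) →
        ∃ A : ℝ, 0 < A ∧ ∃ B₀ : ℝ, 0 ≤ B₀ ∧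
          ∀ f : (Fin n₁ → ℝ) × (Fin n → ℝ) → ℝ, ContDiff ℝ (⊤ : ℕ∞) f → HasCompactSupport f →
            ∫ z, |f z| ^ q * N z ^ (p - 2 * (γ : ℝ)) * |z.1 j₀| ^ (2 * γ) ∂(muW N a p W) ≤
              A * ∫ z, gradLen B f z ^ q ∂(muW N a p W) +
                B₀ * ∫ z, |f z| ^ q ∂(muW N a p W) := by
  have hγ' : (2 : ℝ) ≤ γ := by exact_mod_cast hγ
  have hp4 : 4 ≤ p := by linarith
  have hp0 : 0 < p := by linarith
  have hpq : p.HolderConjugate q := by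
    rw [hq]
    exact Real.HolderConjugate.conjExponent (by linarith)
  have hq1 : 1 < q := hpq.symm.lt
  have hq0 : 0 < q := by linarith
  obtain ⟨K, hK, hxK⟩ := norm_fst_bounded N hN
  have hxK' : ∀ z : (Fin n₁ → ℝ) × (Fin n → ℝ), |z.1 j₀| ≤ K * N z := fun z =>
    (norm_le_pi_norm z.1 j₀).trans (hxK z)
  obtain ⟨K1, hK10, hK1⟩ := XN_bounded B N hN hsm
  choose C hC0 hC using XY_bounded B N hN hsm j₀
  have hCY0 : 0 < ∑ j, C j := Finset.sum_pos (fun j _ => hC0 j) ⟨j₀, Finset.mem_univ _⟩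
  have hCY : ∀ z, |∑ j, Xvf B j (Yfld B N j₀ j) z| ≤ ∑ j, C j := fun z =>
    (Finset.abs_sum_le_sum_abs _ _).trans (Finset.sum_le_sum fun j _ => hC j z)
  have hκ : 0 < a * p * c ^ 2 := by positivity
  have hK2 : 0 < K1 ^ p * K ^ (2 * p - 2 * (γ : ℝ)) := by positivity
  set K2 := K1 ^ p * K ^ (2 * p - 2 * (γ : ℝ)) with hK2d
  set τ : ℝ := (a * p * c ^ 2 / (4 * K2)) ^ p⁻¹ with hτd
  have hτ : 0 < τ := by positivity
  have hτp : 4 * (τ ^ p * K2) ≤ a * p * c ^ 2 := by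
    rw [hτd, Real.rpow_inv_rpow (by positivity) hp0.ne']
    apply le_of_eq
    field_simp
  have hτq : 0 < (τ⁻¹) ^ q := by positivity
  refine ⟨a * p * c ^ 2 / (4 * (τ⁻¹) ^ q), by positivity, ?_⟩
  intro W hW δ γδ hδ hδ0 hγδ hWb _
  have hδ2 : 4 * ((τ⁻¹) ^ q * δ) ≤ a * p * c ^ 2 := by
    rw [lt_div_iff₀ (by positivity)] at hδ0
    linarith
  set κ := a * p * c ^ 2 / 4 with hκd
  have hκ0 : 0 < κ := by positivity
  set A₀ := (τ⁻¹) ^ q * q ^ q with hA0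
  set B₀ := (∑ j, C j + a * p * c ^ 2 * (2 ^ (p - 2 * (γ : ℝ)) * (K * 2) ^ (2 * γ))
    + (τ⁻¹) ^ q * γδ) with hB0
  have hA₀ : 0 < A₀ := by positivity
  have hB₀ : 0 < B₀ := by positivity
  refine ⟨A₀ / κ, by positivity, B₀ / κ, by positivity, ?_⟩
  intro f hf hfc
  obtain ⟨k, hk, hkint⟩ := integral_muW N hN.1 a p hp0.le W hW.continuous
  simp only [hkint]
  have cV : Continuous fun z => Real.exp (-(a * N z ^ p)) := by
    have := hN.1.rpow_const (p := p) fun z => Or.inr hp0.le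
    fun_prop
  have cE : Continuous fun z => Real.exp (-W z) := by
    have := hW.continuous
    fun_prop
  have cw1 : Continuous fun z => N z ^ (p - 2 * (γ : ℝ)) :=
    hN.1.rpow_const fun z => Or.inr (by linarith)
  have cg : Continuous fun z => |f z| ^ q :=
    hf.continuous.abs.rpow_const fun z => Or.inr hq0.le
  have cX : ∀ j, Continuous (Xvf B j f) := by
    intro j
    have h2 : Xvf B j f = fun z => fderiv ℝ f z (vfld B j z) := funext (Xvf_eq B j _)
    rw [h2]
    exact (hf.continuous_fderiv (by simp)).clm_apply (contDiff_vfld B j).continuous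
  have cL : Continuous fun z => gradLen B f z ^ q := by
    refine Continuous.rpow_const ?_ fun z => Or.inr hq0.le
    unfold gradLen gradSq
    exact (continuous_finsetSum _ fun j _ => (cX j).pow 2).sqrt
  have hf0 : ∀ z, z ∉ tsupport f → |f z| ^ q = 0 := by
    intro z hz
    rw [image_eq_zero_of_notMem_tsupport hz, abs_zero, Real.zero_rpow hq0.ne']
  have hL0 : ∀ z, z ∉ tsupport f → gradLen B f z ^ q = 0 := by
    intro z hz
    have : gradLen B f z = 0 := by
      unfold gradLen gradSq
      simp only [Xvf_eq, fderiv_of_notMem_tsupport ℝ hz]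
      simp
    rw [this, Real.zero_rpow hq0.ne']
  have i1 : Integrable (fun z => Real.exp (-(a * N z ^ p)) * Real.exp (-W z) *
      (|f z| ^ q * N z ^ (p - 2 * (γ : ℝ)) * |z.1 j₀| ^ (2 * γ))) := by
    refine Continuous.integrable_of_hasCompactSupport (by fun_prop) ?_
    refine HasCompactSupport.intro hfc fun z hz => ?_
    rw [hf0 z hz]; ring
  have i2 : Integrable (fun z => Real.exp (-(a * N z ^ p)) * Real.exp (-W z) *
      gradLen B f z ^ q) := by
    refine Continuous.integrable_of_hasCompactSupport (by fun_prop) ?_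
    refine HasCompactSupport.intro hfc fun z hz => ?_
    rw [hL0 z hz]; ring
  have i3 : Integrable (fun z => Real.exp (-(a * N z ^ p)) * Real.exp (-W z) * |f z| ^ q) := by
    refine Continuous.integrable_of_hasCompactSupport (by fun_prop) ?_
    refine HasCompactSupport.intro hfc fun z hz => ?_
    rw [hf0 z hz]; ring
  have hreg := fun j => ufld_regular B hskew N hN hsm j₀ a p q hq1 W f hW
    (fun z => δ * (N z ^ (p - 2 * (γ : ℝ)) * |z.1 j₀| ^ (2 * γ)) + γδ) (by fun_prop) hWb hf hfc j
  have hsum : ∫ z, ∑ j, Xvf B j (ufld B N j₀ a p q W f j) z = 0 := by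
    rw [integral_finsetSum _ fun j _ => (hreg j).1]
    exact Finset.sum_eq_zero fun j _ => (hreg j).2
  have hmono := integral_mono (μ := (volume : Measure ((Fin n₁ → ℝ) × (Fin n → ℝ))))
    (f := fun z => ∑ j, Xvf B j (ufld B N j₀ a p q W f j) z)
    (g := fun z => A₀ * (Real.exp (-(a * N z ^ p)) * Real.exp (-W z) * gradLen B f z ^ q)
      + B₀ * (Real.exp (-(a * N z ^ p)) * Real.exp (-W z) * |f z| ^ q)
      - κ * (Real.exp (-(a * N z ^ p)) * Real.exp (-W z) *
      (|f z| ^ q * N z ^ (p - 2 * (γ : ℝ)) * |z.1 j₀| ^ (2 * γ))))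
    (integrable_finsetSum _ fun j _ => (hreg j).1)
    (((i2.const_mul A₀).add (i3.const_mul B₀)).sub (i1.const_mul κ))
    (fun z => by
      refine (pointwise_bound B N hN hsm j₀ γ hγ c hc hG a p q ha hp hpq K K1 (∑ j, C j) τ hK hτ
        hCY0 hxK' hK1 hCY W f hW (hf.differentiable (by simp)) δ γδ hγδ hWb hτp hδ2 z).trans ?_
      apply le_of_eq
      simp only [← hA0, ← hB0, ← hκd]
      ring)
  rw [hsum, integral_sub ((i2.const_mul A₀).fun_add (i3.const_mul B₀)) (i1.const_mul κ),
    integral_add (i2.const_mul A₀) (i3.const_mul B₀), integral_const_mul, integral_const_mul,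
    integral_const_mul] at hmono
  set I1 := ∫ z, Real.exp (-(a * N z ^ p)) * Real.exp (-W z) *
      (|f z| ^ q * N z ^ (p - 2 * (γ : ℝ)) * |z.1 j₀| ^ (2 * γ))
  set I2 := ∫ z, Real.exp (-(a * N z ^ p)) * Real.exp (-W z) * gradLen B f z ^ q
  set I3 := ∫ z, Real.exp (-(a * N z ^ p)) * Real.exp (-W z) * |f z| ^ q
  have hI : I1 ≤ A₀ / κ * I2 + B₀ / κ * I3 := by
    have : I1 ≤ (A₀ * I2 + B₀ * I3) / κ := by
      rw [le_div_iff₀ hκ0]; linarith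
    refine this.trans (le_of_eq ?_)
    ring
  calc k * I1 ≤ k * (A₀ / κ * I2 + B₀ / κ * I3) := by gcongr
    _ = _ := by ring
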